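/- Let A be a 1-level ℓ-quasi-cyclic code of length nA = ℓ·mA over F_q whose polynomial-vector representations of codewords are exactly the F_q[X]/(X^{mA}−1)-multiples of the single row (g^A(X), g^A(X)·f_1(X), …, g^A(X)·f_{ℓ−1}(X)), where g^A divides X^{mA}−1 and f_1,…,f_{ℓ−1} ∈ F_q[X]. Let B be a cyclic code of length nB = mB over F_q with generator polynomial g^B(X) dividing X^{mB}−1. Assume gcd(nA,nB) = 1 and fix integers a, b with a·nA + b·nB = 1; set m = mA·mB and g(X) = gcd(X^m−1, g^A(X^{b·nB})·g^B(X^{a·nA})). Then the set {c(M) : M ∈ A⊗B} of serialized polynomial-vector representations of the product code equals the F_q[X]/(X^m−1)-span of the single row (g(X), g(X)·f_1(X^{b·nB})·X^{−a·mA}, g(X)·f_2(X^{b·nB})·X^{−2·a·mA}, …, g(X)·f_{ℓ−1}(X^{b·nB})·X^{−(ℓ−1)·a·mA}) (entries in F_q[X]/(X^m−1), substitution convention); in particular A⊗B is a 1-level ℓ-quasi-cyclic code. -/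

import Mathlib

open Polynomial

noncomputable section

/-- The quotient ring `F[X]/(X^m - 1)`. -/
abbrev QR (F : Type*) [Field F] (m : ℕ) : Type _ := AdjoinRoot (X ^ m - 1 : F[X])

/-- Canonical projection `F[X] → F[X]/(X^m - 1)`. -/
def qmk (F : Type*) [Field F] (m : ℕ) : F[X] →+* QR F m := AdjoinRoot.mk (X ^ m - 1 : F[X])

/-- The residue `X^t` for an integer `t`, i.e. `X^(t mod m)` in `F[X]/(X^m-1)`. -/
def zX (F : Type*) [Field F] (m : ℕ) (t : ℤ) : QR F m := qmk F m (X ^ (t % (m : ℤ)).toNat)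

/-- Substitution convention: `f(X^t)` as an element of `F[X]/(X^m-1)`. -/
def substX (F : Type*) [Field F] (m : ℕ) (t : ℤ) (f : F[X]) : QR F m :=
  Polynomial.aeval (zX F m t) f

lemma idx_lt {ℓ m : ℕ} (i : Fin m) (j : Fin ℓ) : (i : ℕ) * ℓ + (j : ℕ) < ℓ * m := by
  calc (i : ℕ) * ℓ + (j : ℕ) < (i : ℕ) * ℓ + ℓ := by omega
    _ = ((i : ℕ) + 1) * ℓ := by ring
    _ ≤ m * ℓ := Nat.mul_le_mul_right ℓ i.isLt
    _ = ℓ * m := Nat.mul_comm m ℓ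

/-- Polynomial-vector representation of a codeword of an `ℓ`-quasi-cyclic code:
`c_j(X) = ∑_{i<m} c_{iℓ+j} X^i`. -/
def polyRep {F : Type*} [Semiring F] (ℓ m : ℕ) (c : Fin (ℓ * m) → F) : Fin ℓ → F[X] :=
  fun j => ∑ i : Fin m, Polynomial.monomial (i : ℕ) (c ⟨(i : ℕ) * ℓ + (j : ℕ), idx_lt i j⟩)

/-- A set of words of length `n` is `ℓ`-quasi-cyclic if it is closed under cyclic shift by `ℓ`. -/
def IsQuasiCyclic {F : Type*} {n : ℕ} (ℓ : ℕ) (C : Set (Fin n → F)) : Prop :=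
  ∀ c ∈ C, (fun k : Fin n => c ⟨((k : ℕ) + ℓ) % n, Nat.mod_lt _ k.pos⟩) ∈ C

/-- The set of polynomial-vector representations (mod `X^m-1`) of codewords of `C`. -/
def codePolySet (F : Type*) [Field F] (ℓ m : ℕ) (C : Submodule F (Fin (ℓ * m) → F)) :
    Set (Fin ℓ → QR F m) :=
  { v | ∃ c ∈ C, v = fun j => qmk F m (polyRep ℓ m c j) }

/-- `G` is a generator matrix in RGB/POT form of the `ℓ`-quasi-cyclic code `C` of length `ℓm`. -/
def IsRGBPOT (F : Type*) [Field F] (ℓ m : ℕ) (C : Submodule F (Fin (ℓ * m) → F))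
    (G : Matrix (Fin ℓ) (Fin ℓ) F[X]) : Prop :=
  (∀ i j : Fin ℓ, j < i → G i j = 0) ∧
  (∀ i j : Fin ℓ, j < i → (G j i).degree < (G i i).degree) ∧
  (∀ i : Fin ℓ, G i i ∣ (X ^ m - 1)) ∧
  (∀ i : Fin ℓ, G i i = X ^ m - 1 → ∀ j : Fin ℓ, i < j → G i j = 0) ∧
  codePolySet F ℓ m C =
    ↑(Submodule.span (QR F m) (Set.range fun i => fun j => qmk F m (G i j)))

/-- `M` is a codeword (an `nB × nA` array) of the product code `A ⊗ B`. -/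
def IsProductCW {F : Type*} {nA nB : ℕ} (A : Set (Fin nA → F)) (B : Set (Fin nB → F))
    (M : Fin nB → Fin nA → F) : Prop :=
  (∀ i, M i ∈ A) ∧ (∀ j, (fun i => M i j) ∈ B)

/-- The linear map sending a vector `c` of length `n` to the polynomial `∑ c_i X^i`. -/
def vecPolyL (F : Type*) [CommSemiring F] (n : ℕ) : (Fin n → F) →ₗ[F] F[X] :=
  ∑ i : Fin n, (Polynomial.monomial (i : ℕ)).comp (LinearMap.proj i)

/-- The cyclic code of length `n` with generator polynomial `g`. -/
def cyclicCodeOf (F : Type*) [Field F] (n : ℕ) (g : F[X]) : Submodule F (Fin n → F) :=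
  Submodule.comap (vecPolyL F n) (Submodule.restrictScalars F (Ideal.span {g}))

/-- Serialized polynomial-vector representation of a product-code codeword
(components indexed by pairs `(g, h)` standing for `g + h⬝ℓB`). -/
def ser (F : Type*) [Field F] (ℓA mA ℓB mB : ℕ) (a b : ℤ)
    (M : Fin (ℓB * mB) → Fin (ℓA * mA) → F) : Fin ℓB × Fin ℓA → QR F (mA * mB) :=
  fun p =>
    zX F (mA * mB) (-(p.1 : ℤ) * b * mB - (p.2 : ℤ) * a * mA) *
      ∑ i : Fin mB, ∑ j : Fin mA,
        algebraMap F (QR F (mA * mB))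
            (M ⟨(i : ℕ) * ℓB + (p.1 : ℕ), idx_lt i p.1⟩
               ⟨(j : ℕ) * ℓA + (p.2 : ℕ), idx_lt j p.2⟩) *
          zX F (mA * mB) ((i : ℤ) * (a * (ℓA * mA)) + (j : ℤ) * (b * (ℓB * mB)))

/-- Serialized polynomial-vector representation in the case `ℓB = 1` (column code cyclic). -/
def ser1 (F : Type*) [Field F] (ℓ mA mB : ℕ) (a b : ℤ)
    (M : Fin mB → Fin (ℓ * mA) → F) : Fin ℓ → QR F (mA * mB) :=
  fun h =>
    zX F (mA * mB) (-(h : ℤ) * a * mA) *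
      ∑ i : Fin mB, ∑ j : Fin mA,
        algebraMap F (QR F (mA * mB)) (M i ⟨(j : ℕ) * ℓ + (h : ℕ), idx_lt j h⟩) *
          zX F (mA * mB) ((i : ℤ) * (a * (ℓ * mA)) + (j : ℤ) * (b * mB))

end

noncomputable section
open Polynomial
/-- `g` is the monic greatest common divisor of `p` and `q`. -/
def IsMonicGcd {F : Type*} [Field F] (p q g : F[X]) : Prop :=
  g.Monic ∧ g ∣ p ∧ g ∣ q ∧ ∀ d : F[X], d ∣ p → d ∣ q → d ∣ g
end

noncomputable section
/-- The element of `Fin n` given by an integer `t` reduced mod `n`. -/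
def intModFin (n : ℕ) (hn : 0 < n) (t : ℤ) : Fin n :=
  ⟨(t % (n : ℤ)).toNat, by
    have h1 : 0 ≤ t % (n : ℤ) := Int.emod_nonneg t (by exact_mod_cast hn.ne')
    have h2 : t % (n : ℤ) < (n : ℤ) := Int.emod_lt_of_pos t (by exact_mod_cast hn)
    omega⟩

/-- Integer reduced mod `m`, as a natural number. -/
def natMod (m : ℕ) (t : ℤ) : ℕ := (t % (m : ℤ)).toNat
end

section

variable {F : Type*} [Field F]

lemma qmk_X_pow (m : ℕ) : qmk F m X ^ m = 1 := by
  have h : qmk F m (X ^ m - 1) = 0 := AdjoinRoot.mk_self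
  rwa [map_sub, map_pow, map_one, sub_eq_zero] at h

lemma exists_unit_zpow_eq_zX {m : ℕ} (hm : 0 < m) :
    ∃ u : (QR F m)ˣ, (u : QR F m) = qmk F m X ∧ u ^ m = 1 ∧
      ∀ t : ℤ, zX F m t = ((u ^ t : (QR F m)ˣ) : QR F m) := by
  have hu : Units.ofPowEqOne (qmk F m X) m (qmk_X_pow m) hm.ne' ^ m = 1 :=
    Units.pow_ofPowEqOne (qmk_X_pow m) hm.ne'
  refine ⟨_, Units.val_ofPowEqOne .., hu, fun t => ?_⟩
  rw [zpow_eq_zpow_emod t (n := (m : ℤ)) ((zpow_natCast _ _).trans hu)]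
  lift t % (m : ℤ) to ℕ using Int.emod_nonneg t (by exact_mod_cast hm.ne') with k hk
  simp [zX, ← hk]

lemma zX_add {m : ℕ} (hm : 0 < m) (s t : ℤ) : zX F m (s + t) = zX F m s * zX F m t := by
  obtain ⟨u, -, -, hu⟩ := exists_unit_zpow_eq_zX (F := F) hm
  simp [hu, zpow_add]

lemma zX_natCast_mul {m : ℕ} (hm : 0 < m) (k : ℕ) (t : ℤ) :
    zX F m (k * t) = zX F m t ^ k := by
  obtain ⟨u, -, -, hu⟩ := exists_unit_zpow_eq_zX (F := F) hm
  rw [hu, hu, mul_comm, zpow_mul]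
  simp

lemma zX_one {m : ℕ} (hm : 0 < m) : zX F m 1 = qmk F m X := by
  obtain ⟨u, hX, -, hu⟩ := exists_unit_zpow_eq_zX (F := F) hm
  simp [hu, hX]

lemma zX_eq_one_of_dvd {m : ℕ} (hm : 0 < m) {t : ℤ} (ht : (m : ℤ) ∣ t) : zX F m t = 1 := by
  obtain ⟨u, -, h1, hu⟩ := exists_unit_zpow_eq_zX (F := F) hm
  obtain ⟨k, rfl⟩ := ht
  rw [hu, zpow_mul]
  simp [h1]

lemma qmk_surjective (m : ℕ) : Function.Surjective (qmk F m) := AdjoinRoot.mk_surjective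

lemma aeval_eq_of_qmk_eq {R : Type*} [CommRing R] [Algebra F R] {n : ℕ} {x : R}
    (hx : x ^ n = 1) {p q : F[X]} (h : qmk F n p = qmk F n q) : aeval x p = aeval x q := by
  obtain ⟨s, hs⟩ := AdjoinRoot.mk_eq_mk.1 h
  rw [← sub_eq_zero, ← map_sub, hs]
  simp [hx]

/-- A monic gcd of `X ^ m - 1` and `r` generates the same ideal as `r` modulo `X ^ m - 1`. -/
lemma IsMonicGcd.qmk_dvd_qmk {m : ℕ} {r g : F[X]} (hg : IsMonicGcd (X ^ m - 1) r g) :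
    qmk F m r ∣ qmk F m g ∧ qmk F m g ∣ qmk F m r := by
  classical
  obtain ⟨-, -, hgr, hmax⟩ := hg
  refine ⟨?_, map_dvd _ hgr⟩
  obtain ⟨t, ht⟩ := hmax _ (EuclideanDomain.gcd_dvd_left (X ^ m - 1) r)
    (EuclideanDomain.gcd_dvd_right (X ^ m - 1) r)
  have h0 : qmk F m (X ^ m - 1) = 0 := AdjoinRoot.mk_self
  rw [ht, EuclideanDomain.gcd_eq_gcd_ab (X ^ m - 1) r, map_mul, map_add, map_mul, map_mul, h0,
    zero_mul, zero_add, mul_assoc]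
  exact dvd_mul_right _ _

lemma vecPolyL_apply (n : ℕ) (c : Fin n → F) :
    vecPolyL F n c = ∑ i : Fin n, monomial (i : ℕ) (c i) := by
  simp [vecPolyL]

lemma mem_cyclicCodeOf {n : ℕ} {g : F[X]} {c : Fin n → F} :
    c ∈ cyclicCodeOf F n g ↔ g ∣ vecPolyL F n c := by
  simp [cyclicCodeOf, Ideal.mem_span_singleton]

lemma aeval_vecPolyL {R : Type*} [CommRing R] [Algebra F R] (x : R) {n : ℕ} (c : Fin n → F) :
    aeval x (vecPolyL F n c) = ∑ i : Fin n, algebraMap F R (c i) * x ^ (i : ℕ) := by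
  simp [vecPolyL_apply, aeval_monomial]

lemma aeval_polyRep {R : Type*} [CommRing R] [Algebra F R] (x : R) {ℓ n : ℕ}
    (c : Fin (ℓ * n) → F) (h : Fin ℓ) :
    aeval x (polyRep ℓ n c h) =
      ∑ j : Fin n, algebraMap F R (c ⟨(j : ℕ) * ℓ + (h : ℕ), idx_lt j h⟩) * x ^ (j : ℕ) := by
  simp [polyRep, aeval_monomial]

/-- Reducing a multiple of `g` modulo `X ^ n - 1` yields a codeword of the cyclic code of `g`. -/
lemma exists_mem_cyclicCodeOf {n : ℕ} (hn : 0 < n) {g p : F[X]} (hg : g ∣ X ^ n - 1)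
    (hp : g ∣ p) : ∃ c ∈ cyclicCodeOf F n g, qmk F n (vecPolyL F n c) = qmk F n p := by
  have hmonic : (X ^ n - 1 : F[X]).Monic := monic_X_pow_sub_C 1 hn.ne'
  set s := p %ₘ (X ^ n - 1)
  have hdeg : s.natDegree < n := by
    have := natDegree_modByMonic_lt p hmonic
      (fun h => by simpa [h, hn.ne] using (natDegree_X_pow_sub_C (n := n) (r := (1 : F))))
    rwa [show (X ^ n - 1 : F[X]).natDegree = n from natDegree_X_pow_sub_C (r := (1 : F))] at this
  have hv : vecPolyL F n (fun i => s.coeff i) = s := by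
    rw [vecPolyL_apply, Fin.sum_univ_eq_sum_range (fun i => monomial i (s.coeff i)) n]
    exact (as_sum_range' s n hdeg).symm
  have hsp : s + (X ^ n - 1) * (p /ₘ (X ^ n - 1)) = p := modByMonic_add_div p _
  refine ⟨fun i => s.coeff i, ?_, ?_⟩
  · rw [mem_cyclicCodeOf, hv]
    exact (dvd_add_left (hg.mul_right _)).1 (hsp.symm ▸ hp)
  · rw [hv]
    refine AdjoinRoot.mk_eq_mk.2 ⟨-(p /ₘ (X ^ n - 1)), ?_⟩
    linear_combination hsp

/-- If every column is a multiple of `g` and every row evaluates at `x` to a multiple of `e`,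
then the array evaluates at `(x, y)` to a multiple of `e * g(y)`. -/
lemma mul_aeval_dvd_sum {R : Type*} [CommRing R] [Algebra F R] (x y e : R) {n k : ℕ}
    {g : F[X]} (hg0 : g ≠ 0) (N : Fin n → Fin k → F)
    (hcol : ∀ j, (fun i => N i j) ∈ cyclicCodeOf F n g)
    (hrow : ∀ i, e ∣ ∑ j, algebraMap F R (N i j) * x ^ (j : ℕ)) :
    e * aeval y g ∣
      ∑ i : Fin n, y ^ (i : ℕ) * ∑ j : Fin k, algebraMap F R (N i j) * x ^ (j : ℕ) := by
  obtain ⟨L, hL⟩ := (LinearMap.mulLeft F g).exists_leftInverse_of_injective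
    (LinearMap.ker_eq_bot.2 (mul_right_injective₀ hg0))
  have hdiv : ∀ j, aeval y (vecPolyL F n fun i => N i j) =
      aeval y g * ∑ i : Fin n, algebraMap F R (N i j) * aeval y (L (X ^ (i : ℕ))) := by
    intro j
    have hLsum : L (vecPolyL F n fun i => N i j) = ∑ i : Fin n, N i j • L (X ^ (i : ℕ)) := by
      simp [vecPolyL_apply, ← smul_X_eq_monomial]
    obtain ⟨q, hq⟩ := mem_cyclicCodeOf.1 (hcol j)
    have hLq : L (vecPolyL F n fun i => N i j) = q := by
      rw [hq]
      exact LinearMap.congr_fun hL q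
    rw [hq, map_mul, ← hLq, hLsum]
    simp [Algebra.smul_def]
  have hsum : ∑ i : Fin n, y ^ (i : ℕ) * ∑ j : Fin k, algebraMap F R (N i j) * x ^ (j : ℕ) =
      aeval y g * ∑ i : Fin n, aeval y (L (X ^ (i : ℕ))) *
        ∑ j : Fin k, algebraMap F R (N i j) * x ^ (j : ℕ) := by
    calc _ = ∑ j : Fin k, x ^ (j : ℕ) * aeval y (vecPolyL F n fun i => N i j) := by
          simp only [aeval_vecPolyL, Finset.mul_sum]
          rw [Finset.sum_comm]
          exact Finset.sum_congr rfl fun _ _ => Finset.sum_congr rfl fun _ _ => by ring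
      _ = _ := by
          simp only [hdiv, Finset.mul_sum]
          rw [Finset.sum_comm]
          exact Finset.sum_congr rfl fun _ _ => Finset.sum_congr rfl fun _ _ => by ring
  rw [hsum, mul_comm e]
  exact mul_dvd_mul_left _ (Finset.dvd_sum fun i _ => (hrow i).mul_left _)

lemma ser1_eq_sum {ℓ mA mB : ℕ} (hm : 0 < mA * mB) (a b : ℤ)
    (M : Fin mB → Fin (ℓ * mA) → F) (h : Fin ℓ) :
    ser1 F ℓ mA mB a b M h = zX F (mA * mB) (-((h : ℤ) * a * mA)) *
      ∑ i : Fin mB, zX F (mA * mB) (a * (ℓ * mA)) ^ (i : ℕ) *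
        aeval (zX F (mA * mB) (b * mB)) (polyRep ℓ mA (M i) h) := by
  simp only [ser1, aeval_polyRep, zX_add hm, zX_natCast_mul hm, Finset.mul_sum, neg_mul]
  exact Finset.sum_congr rfl fun _ _ => Finset.sum_congr rfl fun _ _ => by ring

lemma ser1_add (ℓ mA mB : ℕ) (a b : ℤ) (M N : Fin mB → Fin (ℓ * mA) → F) :
    ser1 F ℓ mA mB a b (M + N) = ser1 F ℓ mA mB a b M + ser1 F ℓ mA mB a b N := by
  ext h
  simp [ser1, add_mul, mul_add, Finset.sum_add_distrib]

lemma IsProductCW.add {nA nB : ℕ} {A : Submodule F (Fin nA → F)} {B : Submodule F (Fin nB → F)}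
    {M N : Fin nB → Fin nA → F} (hM : IsProductCW (A : Set _) (B : Set _) M)
    (hN : IsProductCW (A : Set _) (B : Set _) N) :
    IsProductCW (A : Set _) (B : Set _) (M + N) :=
  ⟨fun i => A.add_mem (hM.1 i) (hN.1 i), fun j => B.add_mem (hM.2 j) (hN.2 j)⟩

lemma isProductCW_mul {nA nB : ℕ} {A : Submodule F (Fin nA → F)}
    {B : Submodule F (Fin nB → F)} {c : Fin nA → F} {d : Fin nB → F} (hc : c ∈ A) (hd : d ∈ B) :
    IsProductCW (A : Set _) (B : Set _) fun i j => d i * c j :=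
  ⟨fun i => A.smul_mem (d i) hc, fun j =>
    (funext fun i => mul_comm (c j) (d i) : c j • d = fun i => d i * c j) ▸ B.smul_mem (c j) hd⟩

lemma ser1_mul {ℓ mA mB : ℕ} (hm : 0 < mA * mB) (a b : ℤ)
    (c : Fin (ℓ * mA) → F) (d : Fin mB → F) (h : Fin ℓ) :
    ser1 F ℓ mA mB a b (fun i j => d i * c j) h = zX F (mA * mB) (-((h : ℤ) * a * mA)) *
      (aeval (zX F (mA * mB) (a * (ℓ * mA))) (vecPolyL F mB d) *
        aeval (zX F (mA * mB) (b * mB)) (polyRep ℓ mA c h)) := by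
  rw [ser1_eq_sum hm, aeval_vecPolyL, Finset.sum_mul]
  congr 1
  refine Finset.sum_congr rfl fun i _ => ?_
  simp only [aeval_polyRep, Finset.mul_sum, map_mul]
  exact Finset.sum_congr rfl fun _ _ => by ring

end

theorem generator_matrix_of_one_level_qc_product_code
    (F : Type*) [Field F] [Fintype F]
    (ℓ mA mB : ℕ) (hℓ : 0 < ℓ) (hmA : 0 < mA) (hmB : 0 < mB)
    (A : Submodule F (Fin (ℓ * mA) → F))
    (hAqc : IsQuasiCyclic ℓ (A : Set (Fin (ℓ * mA) → F)))
    (gA : F[X]) (hgA : gA ∣ (X ^ mA - 1))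
    (f : Fin ℓ → F[X]) (hf0 : f ⟨0, hℓ⟩ = 1)
    (hA1level : codePolySet F ℓ mA A
      = ↑(Submodule.span (QR F mA)
          ({fun j : Fin ℓ => qmk F mA (gA * f j)} : Set (Fin ℓ → QR F mA))))
    (gB : F[X]) (hgB : gB ∣ (X ^ mB - 1))
    (hcop : Nat.Coprime (ℓ * mA) mB)
    (a b : ℤ) (hab : a * (ℓ * mA) + b * mB = 1)
    (r : F[X])
    (hr : qmk F (mA * mB) r
      = substX F (mA * mB) (b * mB) gA * substX F (mA * mB) (a * (ℓ * mA)) gB)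
    (g : F[X]) (hg : IsMonicGcd (X ^ (mA * mB) - 1) r g) :
    { v : Fin ℓ → QR F (mA * mB) |
        ∃ M : Fin mB → Fin (ℓ * mA) → F,
          IsProductCW (A : Set _) (cyclicCodeOf F mB gB : Set _) M ∧
            v = ser1 F ℓ mA mB a b M }
      = ↑(Submodule.span (QR F (mA * mB))
          ({fun h : Fin ℓ =>
              qmk F (mA * mB) g * substX F (mA * mB) (b * mB) (f h) *
                zX F (mA * mB) (-((h : ℤ) * a * mA))} :
            Set (Fin ℓ → QR F (mA * mB)))) := by
  have hm : 0 < mA * mB := Nat.mul_pos hmA hmB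
  set U := zX F (mA * mB) (b * mB) with hU
  set V := zX F (mA * mB) (a * (ℓ * mA)) with hV
  have hUV : U * V = qmk F (mA * mB) X := by
    rw [hU, hV, ← zX_add hm, add_comm, hab, zX_one hm]
  have hUpow : U ^ mA = 1 := by
    rw [hU, ← zX_natCast_mul hm]
    exact zX_eq_one_of_dvd hm ⟨b, by push_cast; ring⟩
  have hVpow : V ^ mB = 1 := by
    rw [hV, ← zX_natCast_mul hm]
    exact zX_eq_one_of_dvd hm ⟨a * ℓ, by push_cast; ring⟩
  have hgB0 : gB ≠ 0 := by
    rintro rfl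
    exact (monic_X_pow_sub_C (1 : F) hmB.ne').ne_zero (zero_dvd_iff.1 hgB)
  obtain ⟨hrg, hgr⟩ := hg.qmk_dvd_qmk
  rw [hr] at hrg hgr
  simp only [substX] at hrg hgr ⊢
  rw [← hU, ← hV] at hrg hgr
  ext v
  rw [SetLike.mem_coe, Submodule.mem_span_singleton]
  constructor
  · rintro ⟨M, ⟨hMA, hMB⟩, rfl⟩
    have hrow : ∀ i, ∃ s : F[X], ∀ h, aeval U (polyRep ℓ mA (M i) h) =
        aeval U s * aeval U gA * aeval U (f h) := by
      intro i
      have hmem : (fun j => qmk F mA (polyRep ℓ mA (M i) j)) ∈ codePolySet F ℓ mA A :=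
        ⟨M i, hMA i, rfl⟩
      rw [hA1level, SetLike.mem_coe, Submodule.mem_span_singleton] at hmem
      obtain ⟨e, he⟩ := hmem
      obtain ⟨s, rfl⟩ := qmk_surjective mA e
      refine ⟨s, fun h => ?_⟩
      have hh : qmk F mA (polyRep ℓ mA (M i) h) = qmk F mA (s * (gA * f h)) := by
        rw [map_mul]
        exact (congr_fun he h).symm
      rw [aeval_eq_of_qmk_eq hUpow hh, map_mul, map_mul, mul_assoc]
    choose s hs using hrow
    have hdvd := mul_aeval_dvd_sum U V (aeval U gA) hgB0
      (fun i j => M i ⟨(j : ℕ) * ℓ + ((⟨0, hℓ⟩ : Fin ℓ) : ℕ), idx_lt j _⟩)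
      (fun j => hMB _) (fun i => by
        rw [← aeval_polyRep, hs]
        exact ⟨aeval U (s i), by rw [hf0, map_one]; ring⟩)
    obtain ⟨e, he⟩ := hgr.trans hdvd
    refine ⟨e, funext fun h => ?_⟩
    have he' : ∑ i : Fin mB, V ^ (i : ℕ) * (aeval U (s i) * aeval U gA) =
        qmk F (mA * mB) g * e := by
      rw [← he]
      refine Finset.sum_congr rfl fun i _ => ?_
      rw [← aeval_polyRep, hs, hf0, map_one, mul_one]
    have hfac : ∑ i : Fin mB, V ^ (i : ℕ) * aeval U (polyRep ℓ mA (M i) h) =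
        qmk F (mA * mB) g * e * aeval U (f h) := by
      rw [← he', Finset.sum_mul]
      exact Finset.sum_congr rfl fun i _ => by rw [hs]; ring
    rw [ser1_eq_sum hm, ← hU, ← hV, hfac, Pi.smul_apply, smul_eq_mul]
    ring
  · rintro ⟨e, rfl⟩
    obtain ⟨k, hk⟩ := hrg
    have key : ∀ p : F[X], ∃ M : Fin mB → Fin (ℓ * mA) → F,
        IsProductCW (A : Set _) (cyclicCodeOf F mB gB : Set _) M ∧
          ∀ h, ser1 F ℓ mA mB a b M h = qmk F (mA * mB) p *
            (aeval U gA * aeval V gB * aeval U (f h) *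
              zX F (mA * mB) (-((h : ℤ) * a * mA))) := by
      intro p
      induction p using Polynomial.induction_on' with
      | add p q hp hq =>
        obtain ⟨M, hM, hMs⟩ := hp
        obtain ⟨N, hN, hNs⟩ := hq
        exact ⟨M + N, hM.add hN, fun h => by
          rw [ser1_add, Pi.add_apply, hMs, hNs, map_add, add_mul]⟩
      | monomial n t =>
        obtain ⟨c, hcA, hc⟩ : (fun j => qmk F mA (monomial n t * (gA * f j))) ∈
            codePolySet F ℓ mA A := by
          rw [hA1level, SetLike.mem_coe, Submodule.mem_span_singleton]
          exact ⟨qmk F mA (monomial n t), funext fun j => by simp⟩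
        obtain ⟨d, hdB, hd⟩ := exists_mem_cyclicCodeOf hmB hgB (dvd_mul_left gB (X ^ n))
        refine ⟨_, isProductCW_mul hcA hdB, fun h => ?_⟩
        have ht : qmk F (mA * mB) (monomial n t) =
            algebraMap F (QR F (mA * mB)) t * (U * V) ^ n := by
          rw [hUV, ← C_mul_X_pow_eq_monomial, map_mul, map_pow]
          rfl
        rw [ser1_mul hm, ← hU, ← hV, aeval_eq_of_qmk_eq hVpow hd,
          ← aeval_eq_of_qmk_eq hUpow (congr_fun hc h), ht]
        simp only [map_mul, map_pow, aeval_X, aeval_monomial]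
        ring
    obtain ⟨p, hp⟩ := qmk_surjective (mA * mB) (e * k)
    obtain ⟨M, hM, hMs⟩ := key p
    refine ⟨M, hM, funext fun h => ?_⟩
    rw [hMs, hp, hk, Pi.smul_apply, smul_eq_mul]
    ring
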